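/- Let G = PSL(2,ℤ) with r, u, S = {r, u, u⁻¹} as above. For every g ∈ G the set 𝐒₂(g) has at most 2 elements, and if it has exactly 2 elements then there exists a ∈ {u, u⁻¹} (with ā = a⁻¹) such that 𝐒₂(g) = {ra, aa} or 𝐒₂(g) = {ra, ār}. -/

import Mathlib

namespace PSL2Z

abbrev SL2Z : Type := Matrix.SpecialLinearGroup (Fin 2) ℤ

/-- `PSL(2,ℤ)`: the quotient of `SL(2,ℤ)` by its center `{±I}`. -/
abbrev G : Type := SL2Z ⧸ Subgroup.center SL2Z

/-- The image in `PSL(2,ℤ)` of the matrix `[[0,1],[-1,0]]`. -/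
def r : G := QuotientGroup.mk (⟨!![0, 1; -1, 0], by norm_num [Matrix.det_fin_two_of]⟩ : SL2Z)

/-- The image in `PSL(2,ℤ)` of the matrix `[[1,1],[0,1]]`. -/
def u : G := QuotientGroup.mk (⟨!![1, 1; 0, 1], by norm_num [Matrix.det_fin_two_of]⟩ : SL2Z)

/-- The symmetric generating set `S = {r, u, u⁻¹}`. -/
def S : Set G := {r, u, u⁻¹}

/-- A word in `S`: a finite list of elements of `S`. -/
def IsWord (w : List G) : Prop := ∀ x ∈ w, x ∈ S

/-- The word norm `|g|`: the least length of a word in `S` representing `g`. -/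
noncomputable def wordNorm (g : G) : ℕ :=
  sInf {n | ∃ w : List G, IsWord w ∧ w.prod = g ∧ w.length = n}

/-- A geodesic for `g`: a word in `S` representing `g` of length `|g|`. -/
def IsGeodesic (g : G) (w : List G) : Prop :=
  IsWord w ∧ w.prod = g ∧ w.length = wordNorm g

/-- `𝐒ₙ(g)`: the set of suffixes of length `n` of geodesics for `g`. -/
def Suf (n : ℕ) (g : G) : Set (List G) :=
  {v | v.length = n ∧ ∃ w : List G, IsGeodesic g w ∧ v <:+ w}

open Classical in
/-- `𝐒₂*(g)`: `𝐒₂(g)` if nonempty, otherwise `𝐒₁(g)` (which is `∅` exactly when `g = 1`). -/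
noncomputable def Suf2Star (g : G) : Set (List G) :=
  if (Suf 2 g).Nonempty then Suf 2 g else Suf 1 g

/-- `S⁺(g) = {s ∈ S : |g·s| = |g| + 1}`. -/
def Splus (g : G) : Set G := {s ∈ S | wordNorm (g * s) = wordNorm g + 1}

/-! ### Relations between the generators -/

/-- The generator `u` (for `true`) or its inverse (for `false`). -/
def letter (c : Bool) : G := if c then u else u⁻¹

/-- The matrix `[[1,1],[0,1]]` (for `true`) or `[[1,0],[1,1]]` (for `false`). -/
def elemMat (c : Bool) : SL2Z :=
  if c then ⟨!![1, 1; 0, 1], by norm_num [Matrix.det_fin_two_of]⟩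
  else ⟨!![1, 0; 1, 1], by norm_num [Matrix.det_fin_two_of]⟩

lemma mk_eq_mk_iff (A B : SL2Z) : (QuotientGroup.mk A : G) = QuotientGroup.mk B ↔
    A = B ∨ A = -B := by
  rw [QuotientGroup.eq, Matrix.SpecialLinearGroup.mem_center_iff]
  constructor
  · rintro ⟨z, hz, h⟩
    have hz' : z = 1 ∨ z = -1 := by
      rwa [Fintype.card_fin, sq_eq_one_iff] at hz
    have hB : B = A * (A⁻¹ * B) := by group
    rcases hz' with rfl | rfl
    · left
      have h1 : A⁻¹ * B = 1 := by
        apply Subtype.ext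
        rw [← h]; simp
      rw [hB, h1, mul_one]
    · right
      have h1 : A⁻¹ * B = -1 := by
        apply Subtype.ext
        rw [← h]
        ext i j
        fin_cases i <;> fin_cases j <;> simp
      rw [hB, h1]; simp
  · rintro (rfl | rfl)
    · exact ⟨1, by simp, by simp⟩
    · refine ⟨-1, by simp, ?_⟩
      have : (-B)⁻¹ * B = -1 := by
        rw [inv_mul_eq_iff_eq_mul]; simp
      rw [this]
      ext i j
      fin_cases i <;> fin_cases j <;> simp

/-- The matrix `[[0,1],[-1,0]]`. -/
def rMat : SL2Z := ⟨!![0, 1; -1, 0], by norm_num [Matrix.det_fin_two_of]⟩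

lemma r_eq_mk : r = QuotientGroup.mk rMat := rfl

lemma u_eq_mk : u = QuotientGroup.mk (elemMat true) := rfl

lemma rMat_entries : rMat 0 0 = 0 ∧ rMat 0 1 = 1 ∧ rMat 1 0 = -1 ∧ rMat 1 1 = 0 :=
  ⟨rfl, rfl, rfl, rfl⟩

lemma elemMat_true_entries : elemMat true 0 0 = 1 ∧ elemMat true 0 1 = 1 ∧
    elemMat true 1 0 = 0 ∧ elemMat true 1 1 = 1 :=
  ⟨rfl, rfl, rfl, rfl⟩

lemma elemMat_false_entries : elemMat false 0 0 = 1 ∧ elemMat false 0 1 = 0 ∧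
    elemMat false 1 0 = 1 ∧ elemMat false 1 1 = 1 :=
  ⟨rfl, rfl, rfl, rfl⟩

lemma mul_entry (A B : SL2Z) (i j : Fin 2) : (A * B) i j = A i 0 * B 0 j + A i 1 * B 1 j := by
  rw [Matrix.SpecialLinearGroup.coe_mul, Matrix.mul_apply, Fin.sum_univ_two]

lemma neg_entry (A : SL2Z) (i j : Fin 2) : (-A) i j = -A i j := rfl

lemma ext_entries {A B : SL2Z} (h00 : A 0 0 = B 0 0) (h01 : A 0 1 = B 0 1)
    (h10 : A 1 0 = B 1 0) (h11 : A 1 1 = B 1 1) : A = B := by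
  ext i j
  fin_cases i <;> fin_cases j <;> assumption

lemma r_mul_r : r * r = 1 := by
  rw [r_eq_mk, ← QuotientGroup.mk_mul, ← QuotientGroup.mk_one, mk_eq_mk_iff]
  right
  apply ext_entries <;> simp [mul_entry, neg_entry, rMat_entries]

lemma r_inv : r⁻¹ = r := inv_eq_of_mul_eq_one_left r_mul_r

lemma r_mul_r_mul (g : G) : r * (r * g) = g := by rw [← mul_assoc, r_mul_r, one_mul]

lemma u_mul_r_mul_u : u * r * u = r * u⁻¹ * r := by
  have h : u * r * u * (r * u) = r := by
    rw [r_eq_mk, u_eq_mk]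
    simp only [← QuotientGroup.mk_mul]
    rw [mk_eq_mk_iff]
    right
    apply ext_entries <;> simp [mul_entry, neg_entry, rMat_entries, elemMat_true_entries]
  rw [eq_mul_inv_of_mul_eq h, mul_inv_rev, r_inv, mul_assoc]

lemma mk_elemMat_false : (QuotientGroup.mk (elemMat false) : G) = r * u⁻¹ * r := by
  rw [← u_mul_r_mul_u, r_eq_mk, u_eq_mk]
  simp only [← QuotientGroup.mk_mul]
  rw [mk_eq_mk_iff]
  right
  apply ext_entries <;>
    simp [mul_entry, neg_entry, rMat_entries, elemMat_true_entries, elemMat_false_entries]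

lemma letter_not (c : Bool) : letter (!c) = (letter c)⁻¹ := by
  cases c <;> simp [letter]

/-- The hexagon relation of the Cayley graph. -/
lemma letter_mul_r_mul_letter (c : Bool) :
    letter c * r * letter c = r * (letter c)⁻¹ * r := by
  cases c
  · have h := congrArg (fun g => g⁻¹) u_mul_r_mul_u
    simp only [mul_inv_rev, inv_inv, r_inv, mul_assoc] at h
    simp only [letter, Bool.false_eq_true, if_false, inv_inv, mul_assoc]
    exact h
  · exact u_mul_r_mul_u

lemma letter_mem_S (c : Bool) : letter c ∈ S := by
  cases c <;> simp [letter, S]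

lemma mem_S_iff {t : G} : t ∈ S ↔ t = r ∨ ∃ c, t = letter c := by
  simp [S, letter, or_comm]

/-! ### Coding vertices of the Cayley graph

The Cayley graph is a tree of hexagons glued along the edges labelled `r`. Such an edge is coded
by a starting side `s` and the list of turns `W` (last one first) leading to it. -/

/-- The side on which the next hexagon lies. -/
def side (s : Bool) (W : List Bool) : Bool := W.headD s

/-- The end closest to `1` of the edge coded by `s` and `W`. -/
def base (s : Bool) : List Bool → G
  | [] => 1
  | c :: W => base s W * (if c = side s W then 1 else r) * letter c

/-- The distance to `1` of `base s W`. -/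
def baseLen (s : Bool) : List Bool → ℕ
  | [] => 0
  | c :: W => baseLen s W + (if c = side s W then 1 else 2)

/-- The closer (for `false`) or farther (for `true`) end of the edge coded by `s` and `W`. -/
def vert (s : Bool) (W : List Bool) (k : Bool) : G := base s W * (if k then r else 1)

/-- The distance to `1` of `vert s W k`. -/
def len (s : Bool) (W : List Bool) (k : Bool) : ℕ := baseLen s W + (if k then 1 else 0)

/-- The product of elementary matrices coded by `W`, last factor first. -/
def mat : List Bool → SL2Z
  | [] => 1
  | c :: W => mat W * elemMat c

lemma base_mul_eq_mk_mat (s : Bool) (W : List Bool) :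
    base s W * (if side s W then 1 else r) = (if s then 1 else r) * QuotientGroup.mk (mat W) := by
  induction W with
  | nil => cases s <;> simp [base, side, mat]
  | cons c W ih =>
    rw [mat, QuotientGroup.mk_mul, ← mul_assoc, ← ih, base]
    change _ * (if c then (1 : G) else r) = _
    cases c <;> cases side s W <;>
      simp [← u_eq_mk, mk_elemMat_false, letter, mul_assoc, r_mul_r_mul]

lemma mat_nonneg (W : List Bool) : 0 < mat W 0 0 ∧ 0 ≤ mat W 0 1 ∧ 0 ≤ mat W 1 0 ∧
    0 < mat W 1 1 := by
  induction W with
  | nil => simp [mat]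
  | cons c W ih =>
    cases c <;>
      simp [mat, mul_entry, elemMat_true_entries, elemMat_false_entries] <;> omega

lemma mat_entries_cons_true (W : List Bool) :
    mat (true :: W) 0 0 = mat W 0 0 ∧ mat (true :: W) 0 1 = mat W 0 0 + mat W 0 1 ∧
    mat (true :: W) 1 0 = mat W 1 0 ∧ mat (true :: W) 1 1 = mat W 1 0 + mat W 1 1 := by
  simp [mat, mul_entry, elemMat_true_entries]

lemma mat_entries_cons_false (W : List Bool) :
    mat (false :: W) 0 0 = mat W 0 0 + mat W 0 1 ∧ mat (false :: W) 0 1 = mat W 0 1 ∧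
    mat (false :: W) 1 0 = mat W 1 0 + mat W 1 1 ∧ mat (false :: W) 1 1 = mat W 1 1 := by
  simp [mat, mul_entry, elemMat_false_entries]

lemma mat_cons_ne_one (c : Bool) (W : List Bool) : mat (c :: W) ≠ 1 := by
  intro h
  have h1 : mat (c :: W) 0 1 = 0 := by rw [h]; rfl
  have h2 : mat (c :: W) 1 0 = 0 := by rw [h]; rfl
  have := mat_nonneg W
  cases c
  · have := mat_entries_cons_false W; omega
  · have := mat_entries_cons_true W; omega

lemma mat_injective : Function.Injective mat := by
  intro V
  induction V with
  | nil =>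
    rintro (_ | ⟨c, W⟩) h
    · rfl
    · exact (mat_cons_ne_one c W h.symm).elim
  | cons b V ih =>
    rintro (_ | ⟨c, W⟩) h
    · exact (mat_cons_ne_one b V h).elim
    · by_cases hbc : b = c
      · subst hbc
        rw [ih (mul_right_cancel h)]
      · exfalso
        have h00 : mat (b :: V) 0 0 = mat (c :: W) 0 0 := by rw [h]
        have h01 : mat (b :: V) 0 1 = mat (c :: W) 0 1 := by rw [h]
        have := mat_nonneg V
        have := mat_nonneg W
        cases b <;> cases c
        · exact hbc rfl
        · have := mat_entries_cons_false V
          have := mat_entries_cons_true W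
          omega
        · have := mat_entries_cons_true V
          have := mat_entries_cons_false W
          omega
        · exact hbc rfl

lemma entries_of_mk_eq {A B : SL2Z} (h : (QuotientGroup.mk A : G) = QuotientGroup.mk B) :
    (A 0 0 = B 0 0 ∧ A 0 1 = B 0 1 ∧ A 1 0 = B 1 0 ∧ A 1 1 = B 1 1) ∨
    (A 0 0 = -B 0 0 ∧ A 0 1 = -B 0 1 ∧ A 1 0 = -B 1 0 ∧ A 1 1 = -B 1 1) := by
  rcases (mk_eq_mk_iff A B).mp h with rfl | rfl <;> simp

lemma mk_mat_inj {V W : List Bool}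
    (h : (QuotientGroup.mk (mat V) : G) = QuotientGroup.mk (mat W)) : V = W := by
  apply mat_injective
  have := mat_nonneg V
  have := mat_nonneg W
  rcases entries_of_mk_eq h with ⟨h1, h2, h3, h4⟩ | h
  · exact ext_entries h1 h2 h3 h4
  · omega

lemma mk_mat_mul_r_ne (V W : List Bool) :
    (QuotientGroup.mk (mat V) : G) * r ≠ QuotientGroup.mk (mat W) := by
  intro h
  rw [r_eq_mk, ← QuotientGroup.mk_mul] at h
  have := mat_nonneg V
  have := mat_nonneg W
  have := entries_of_mk_eq h
  simp only [mul_entry, rMat_entries] at this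
  omega

lemma r_mul_mk_mat_ne (V W : List Bool) :
    r * (QuotientGroup.mk (mat V) : G) ≠ QuotientGroup.mk (mat W) := by
  intro h
  rw [r_eq_mk, ← QuotientGroup.mk_mul] at h
  have := mat_nonneg V
  have := mat_nonneg W
  have := entries_of_mk_eq h
  simp only [mul_entry, rMat_entries] at this
  omega

lemma eq_nil_of_r_mul_mk_mat_eq {V W : List Bool}
    (h : r * (QuotientGroup.mk (mat V) : G) = QuotientGroup.mk (mat W) * r) :
    V = [] ∧ W = [] := by
  rw [r_eq_mk, ← QuotientGroup.mk_mul, ← QuotientGroup.mk_mul] at h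
  have hV := mat_nonneg V
  have hW := mat_nonneg W
  have h' := entries_of_mk_eq h
  simp only [mul_entry, rMat_entries] at h'
  constructor
  · rcases V with _ | ⟨c, V⟩
    · rfl
    · have := mat_nonneg V
      have := mat_entries_cons_false V
      have := mat_entries_cons_true V
      cases c <;> omega
  · rcases W with _ | ⟨c, W⟩
    · rfl
    · have := mat_nonneg W
      have := mat_entries_cons_false W
      have := mat_entries_cons_true W
      cases c <;> omega

lemma vert_eq_mk_mat (s : Bool) (W : List Bool) (k : Bool) :
    vert s W k = (if s then 1 else r) * QuotientGroup.mk (mat W) *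
      (if k = side s W then r else 1) := by
  rw [← base_mul_eq_mk_mat, vert]
  cases k <;> cases side s W <;> simp [mul_assoc, r_mul_r]

lemma r_ne_one : r ≠ 1 := by
  have := mk_mat_mul_r_ne [] []
  simpa [mat] using this

lemma len_eq_of_vert_eq {s s' k k' : Bool} {W W' : List Bool}
    (h : vert s W k = vert s' W' k') : len s W k = len s' W' k' := by
  have hr (g g' : G) (h : g = r * g') : r * g = g' := by rw [h, r_mul_r_mul]
  have hm (g g' : G) (h : g * r = g') : g = g' * r := by rw [← h, mul_assoc, r_mul_r, mul_one]
  have key : s = s' ∧ W = W' ∧ k = k' ∨ W = [] ∧ W' = [] := by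
    have h0 := h
    rw [vert_eq_mk_mat, vert_eq_mk_mat] at h0
    by_cases hs : s = s'
    · subst hs
      left
      rw [mul_assoc, mul_assoc] at h0
      replace h0 := mul_left_cancel h0
      by_cases h1 : k = side s W <;> by_cases h2 : k' = side s W' <;>
        simp only [h1, h2, if_true, if_false, mul_one] at h0
      · obtain rfl := mk_mat_inj (mul_right_cancel h0)
        exact ⟨rfl, rfl, h1.trans h2.symm⟩
      · exact (mk_mat_mul_r_ne _ _ h0).elim
      · exact (mk_mat_mul_r_ne _ _ h0.symm).elim
      · obtain rfl := mk_mat_inj h0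
        refine ⟨rfl, rfl, ?_⟩
        revert h1 h2
        cases k <;> cases k' <;> simp
    · right
      have h1 : r * (QuotientGroup.mk (mat W) : G) * (if k = side s W then r else 1) =
          QuotientGroup.mk (mat W') * (if k' = side s' W' then r else 1) := by
        cases s <;> cases s'
        · exact (hs rfl).elim
        · simpa using h0
        · rw [mul_assoc]
          exact hr _ _ (by simpa [mul_assoc] using h0)
        · exact (hs rfl).elim
      split_ifs at h1
      · exact (r_mul_mk_mat_ne _ _ (mul_right_cancel h1)).elim
      · rw [mul_one] at h1
        exact eq_nil_of_r_mul_mk_mat_eq (hm _ _ h1)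
      · rw [mul_one] at h1
        exact eq_nil_of_r_mul_mk_mat_eq h1
      · rw [mul_one, mul_one] at h1
        exact (r_mul_mk_mat_ne _ _ h1).elim
  rcases key with ⟨rfl, rfl, rfl⟩ | ⟨rfl, rfl⟩
  · rfl
  · simp only [vert, base, one_mul] at h
    clear hr hm
    cases k <;> cases k' <;> simp_all [len, baseLen, r_ne_one, r_ne_one.symm]

/-! ### Neighbours in the Cayley graph -/

lemma vert_mul_r (s : Bool) (W : List Bool) (k : Bool) : vert s W k * r = vert s W (!k) := by
  cases k <;> simp [vert, mul_assoc, r_mul_r]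

lemma vert_false_mul_letter_side (s : Bool) (W : List Bool) :
    vert s W false * letter (side s W) = vert s (side s W :: W) false := by
  simp [vert, base]

lemma vert_true_mul_letter_not_side (s : Bool) (W : List Bool) :
    vert s W true * letter (!side s W) = vert s ((!side s W) :: W) false := by
  simp [vert, base]

lemma vert_cons_false_mul_letter_not (s c : Bool) (W : List Bool) :
    vert s (c :: W) false * letter (!c) = vert s W (c != side s W) := by
  rw [letter_not]
  by_cases h : c = side s W <;> simp [vert, base, h]

lemma vert_cons_true_mul_letter (s c : Bool) (W : List Bool) :
    vert s (c :: W) true * letter c = vert s ((!c) :: W) true := by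
  have h := letter_mul_r_mul_letter c
  simp only [mul_assoc] at h
  have hc : ((!c) = side s W) ↔ ¬ c = side s W := by cases c <;> cases side s W <;> simp
  simp only [vert, base, hc, letter_not, if_true, mul_assoc, h]
  by_cases h' : c = side s W <;> simp [h', r_mul_r_mul]

lemma vert_nil_false_mul_letter_not (s : Bool) :
    vert s [] false * letter (!s) = vert (!s) [!s] false := by
  simp [vert, base, side]

lemma vert_nil_true_mul_letter (s : Bool) :
    vert s [] true * letter s = vert (!s) [s] false := by
  simp [vert, base, side]

/-! ### The word norm -/

lemma exists_vert_mul_eq (s : Bool) (W : List Bool) (k : Bool) {t : G} (ht : t ∈ S) :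
    ∃ s' W' k', vert s' W' k' = vert s W k * t ∧ len s' W' k' ≤ len s W k + 1 := by
  rcases mem_S_iff.mp ht with rfl | ⟨c, rfl⟩
  · exact ⟨s, W, !k, (vert_mul_r s W k).symm, by cases k <;> simp [len]; omega⟩
  · cases k
    · rcases Bool.eq_or_eq_not c (side s W) with rfl | h
      · exact ⟨_, _, _, (vert_false_mul_letter_side s W).symm, by simp [len, baseLen]⟩
      · rcases W with _ | ⟨b, W⟩
        · obtain rfl : c = !s := h
          exact ⟨_, _, _, (vert_nil_false_mul_letter_not s).symm, by simp [len, baseLen, side]⟩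
        · obtain rfl : c = !b := h
          refine ⟨_, _, _, (vert_cons_false_mul_letter_not s b W).symm, ?_⟩
          by_cases h : b = side s W
          · simp [len, baseLen, h]
            omega
          · simp [len, baseLen, h]
    · rcases Bool.eq_or_eq_not c (side s W) with h | rfl
      · rcases W with _ | ⟨b, W⟩
        · obtain rfl : c = s := h
          exact ⟨_, _, _, (vert_nil_true_mul_letter c).symm, by simp [len, baseLen, side]⟩
        · obtain rfl : c = b := h
          refine ⟨_, _, _, (vert_cons_true_mul_letter s c W).symm, ?_⟩
          simp only [len, baseLen]
          split_ifs <;> omega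
      · exact ⟨_, _, _, (vert_true_mul_letter_not_side s W).symm, by simp [len, baseLen]⟩

lemma exists_vert_eq_prod (w : List G) (hw : IsWord w) :
    ∃ s W k, vert s W k = w.prod ∧ len s W k ≤ w.length := by
  induction w using List.reverseRecOn with
  | nil => exact ⟨true, [], false, by simp [vert, base], by simp [len, baseLen]⟩
  | append_singleton w t ih =>
    obtain ⟨s, W, k, h, hl⟩ := ih fun x hx => hw x (by simp [hx])
    obtain ⟨s', W', k', h', hl'⟩ := exists_vert_mul_eq s W k (hw t (by simp))
    exact ⟨s', W', k', by simp [h', h], by simp; omega⟩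

lemma IsWord.append {v w : List G} (hv : IsWord v) (hw : IsWord w) : IsWord (v ++ w) := by
  intro x hx
  rcases List.mem_append.mp hx with h | h
  exacts [hv x h, hw x h]

lemma isWord_singleton {t : G} (ht : t ∈ S) : IsWord [t] := by
  simpa [IsWord] using ht

lemma r_mem_S : r ∈ S := by simp [S]

lemma exists_word_base (s : Bool) (W : List Bool) :
    ∃ w : List G, IsWord w ∧ w.prod = base s W ∧ w.length = baseLen s W := by
  induction W with
  | nil => exact ⟨[], by simp [IsWord], rfl, rfl⟩
  | cons c W ih =>
    obtain ⟨w, hw, hp, hl⟩ := ih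
    by_cases h : c = side s W
    · exact ⟨w ++ [letter c], hw.append (isWord_singleton (letter_mem_S c)),
        by simp [base, h, hp], by simp [baseLen, h, hl]⟩
    · exact ⟨w ++ [r] ++ [letter c],
        (hw.append (isWord_singleton r_mem_S)).append (isWord_singleton (letter_mem_S c)),
        by simp [base, h, hp, mul_assoc], by simp [baseLen, h, hl]⟩

lemma exists_word_vert (s : Bool) (W : List Bool) (k : Bool) :
    ∃ w : List G, IsWord w ∧ w.prod = vert s W k ∧ w.length = len s W k := by
  obtain ⟨w, hw, hp, hl⟩ := exists_word_base s W
  cases k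
  · exact ⟨w, hw, by simp [vert, hp], by simp [len, hl]⟩
  · exact ⟨w ++ [r], hw.append (isWord_singleton r_mem_S), by simp [vert, hp], by simp [len, hl]⟩

lemma wordNorm_vert (s : Bool) (W : List Bool) (k : Bool) :
    wordNorm (vert s W k) = len s W k := by
  apply le_antisymm
  · exact Nat.sInf_le (exists_word_vert s W k)
  · refine le_csInf ⟨_, exists_word_vert s W k⟩ ?_
    rintro n ⟨w, hw, hp, rfl⟩
    obtain ⟨s', W', k', h, hl⟩ := exists_vert_eq_prod w hw
    rwa [← len_eq_of_vert_eq (h.trans hp)]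

lemma wordNorm_prod_le {w : List G} (hw : IsWord w) : wordNorm w.prod ≤ w.length :=
  Nat.sInf_le ⟨w, hw, rfl, rfl⟩

/-! ### Last letters of geodesics -/

/-- `t` is the last letter of a geodesic for `g`, for `g` in the group generated by `S`. -/
def IsLast (g t : G) : Prop := t ∈ S ∧ wordNorm (g * t⁻¹) < wordNorm g

lemma isLast_of_mem_Suf_two {g : G} {v : List G} (hv : v ∈ Suf 2 g) :
    ∃ a b, v = [a, b] ∧ IsLast g b ∧ IsLast (g * b⁻¹) a := by
  obtain ⟨hv2, w, ⟨hw, hp, hl⟩, w', rfl⟩ := hv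
  obtain ⟨a, b, rfl⟩ := List.length_eq_two.mp hv2
  have ha : a ∈ S := hw a (by simp)
  have hb : b ∈ S := hw b (by simp)
  have hw' : IsWord w' := fun x hx => hw x (by simp [hx])
  have e1 : g * b⁻¹ = (w' ++ [a]).prod := by simp [← hp, ← mul_assoc]
  have e2 : g * b⁻¹ * a⁻¹ = w'.prod := by simp [e1]
  have l1 := wordNorm_prod_le (hw'.append (isWord_singleton ha))
  have l2 := wordNorm_prod_le hw'
  obtain ⟨s, W, k, h, -⟩ := exists_vert_eq_prod _ (hw'.append (isWord_singleton ha))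
  obtain ⟨s', W', k', h', hl'⟩ := exists_vert_mul_eq s W k hb
  have l3 : wordNorm g ≤ wordNorm (g * b⁻¹) + 1 := by
    have e3 : vert s' W' k' = g := by rw [h', h, ← e1]; simp
    rw [e1, ← h, wordNorm_vert, ← e3, wordNorm_vert]
    exact hl'
  rw [← e1] at l1
  rw [← e2] at l2
  simp only [List.length_append, List.length_cons, List.length_nil] at l1 hl
  exact ⟨a, b, rfl, ⟨hb, by omega⟩, ha, by omega⟩

lemma IsLast.eq_r_or {g t : G} (h : IsLast g t) :
    (t = r ∧ wordNorm (g * r) < wordNorm g) ∨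
      ∃ c, t = letter c ∧ wordNorm (g * letter (!c)) < wordNorm g := by
  obtain ⟨ht, h⟩ := h
  rcases mem_S_iff.mp ht with rfl | ⟨c, rfl⟩
  · rw [r_inv] at h
    exact Or.inl ⟨rfl, h⟩
  · rw [← letter_not] at h
    exact Or.inr ⟨c, rfl, h⟩

lemma not_isLast_vert_nil_false (s : Bool) (t : G) : ¬ IsLast (vert s [] false) t := by
  rintro ⟨-, h⟩
  simp [wordNorm_vert, len, baseLen] at h

lemma IsLast.eq_of_vert_nil_true {s : Bool} {t : G} (ht : IsLast (vert s [] true) t) : t = r := by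
  rcases ht.eq_r_or with ⟨rfl, -⟩ | ⟨c, rfl, h⟩
  · rfl
  · exfalso
    rcases Bool.eq_or_eq_not c s with rfl | rfl
    · rw [show (!c) = !side c [] from rfl, vert_true_mul_letter_not_side] at h
      simp [wordNorm_vert, len, baseLen, side] at h
    · rw [Bool.not_not, vert_nil_true_mul_letter] at h
      simp [wordNorm_vert, len, baseLen, side] at h

lemma IsLast.eq_of_vert_cons_false {s c : Bool} {W : List Bool} {t : G}
    (ht : IsLast (vert s (c :: W) false) t) : t = letter c := by
  rcases ht.eq_r_or with ⟨rfl, h⟩ | ⟨b, rfl, h⟩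
  · rw [vert_mul_r] at h
    simp [wordNorm_vert, len] at h
  · rcases Bool.eq_or_eq_not b c with rfl | rfl
    · rfl
    · exfalso
      rw [Bool.not_not] at h
      have h' := vert_false_mul_letter_side s (c :: W)
      rw [show side s (c :: W) = c from rfl] at h'
      rw [h', wordNorm_vert, wordNorm_vert] at h
      simp [len, baseLen, side] at h

lemma IsLast.eq_or_of_vert_cons_true {s c : Bool} {W : List Bool} {t : G}
    (ht : IsLast (vert s (c :: W) true) t) : t = r ∨ t = letter (!c) ∧ c ≠ side s W := by
  rcases ht.eq_r_or with ⟨rfl, -⟩ | ⟨b, rfl, h⟩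
  · exact Or.inl rfl
  · rcases Bool.eq_or_eq_not b c with rfl | rfl
    · exfalso
      have h' := vert_true_mul_letter_not_side s (b :: W)
      rw [show side s (b :: W) = b from rfl] at h'
      rw [h', wordNorm_vert, wordNorm_vert] at h
      simp [len, baseLen, side] at h
    · refine Or.inr ⟨rfl, ?_⟩
      rintro rfl
      rw [Bool.not_not, vert_cons_true_mul_letter, wordNorm_vert, wordNorm_vert] at h
      simp [len, baseLen] at h

lemma exists_Suf_two_vert_subset (s : Bool) (W : List Bool) (k : Bool) :
    ∃ c : Bool, Suf 2 (vert s W k) ⊆ {[r, letter c], [letter c, letter c]} ∨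
      Suf 2 (vert s W k) ⊆ {[r, letter c], [(letter c)⁻¹, r]} := by
  rcases W with _ | ⟨c, W⟩
  · refine ⟨true, Or.inl fun v hv => ?_⟩
    obtain ⟨a, b, rfl, hb, ha⟩ := isLast_of_mem_Suf_two hv
    cases k
    · exact (not_isLast_vert_nil_false s b hb).elim
    · obtain rfl := hb.eq_of_vert_nil_true
      rw [r_inv, vert_mul_r] at ha
      exact (not_isLast_vert_nil_false s a ha).elim
  · cases k
    · refine ⟨c, Or.inl fun v hv => ?_⟩
      obtain ⟨a, b, rfl, hb, ha⟩ := isLast_of_mem_Suf_two hv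
      obtain rfl := hb.eq_of_vert_cons_false
      rw [← letter_not, vert_cons_false_mul_letter_not] at ha
      rcases W with _ | ⟨d, W⟩
      · cases h : (c != side s [])
        · rw [h] at ha
          exact (not_isLast_vert_nil_false s a ha).elim
        · rw [h] at ha
          simp [ha.eq_of_vert_nil_true]
      · rw [show side s (d :: W) = d from rfl] at ha
        rcases Bool.eq_or_eq_not c d with rfl | rfl
        · rw [bne_self_eq_false] at ha
          simp [ha.eq_of_vert_cons_false]
        · rw [show ((!d) != d) = true by cases d <;> rfl] at ha
          rcases ha.eq_or_of_vert_cons_true with rfl | ⟨rfl, -⟩ <;> simp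
    · refine ⟨!c, Or.inr fun v hv => ?_⟩
      obtain ⟨a, b, rfl, hb, ha⟩ := isLast_of_mem_Suf_two hv
      rcases hb.eq_or_of_vert_cons_true with rfl | ⟨rfl, hc⟩
      · rw [r_inv, vert_mul_r] at ha
        simp [ha.eq_of_vert_cons_false, letter_not]
      · rw [← letter_not, Bool.not_not, vert_cons_true_mul_letter] at ha
        rcases ha.eq_or_of_vert_cons_true with rfl | ⟨-, hc'⟩
        · simp
        · revert hc hc'
          cases c <;> cases side s W <;> simp

/-- For every `g ∈ PSL(2,ℤ)`, the set `𝐒₂(g)` has at most two elements, and if it has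
exactly two then `𝐒₂(g) = {ra, aa}` or `{ra, ār}` for some `a ∈ {u, u⁻¹}`. -/
theorem suf2_card (g : G) :
    (Suf 2 g).encard ≤ 2 ∧
    ((Suf 2 g).encard = 2 → ∃ a ∈ ({u, u⁻¹} : Set G),
      Suf 2 g = {[r, a], [a, a]} ∨ Suf 2 g = {[r, a], [a⁻¹, r]}) := by
  rcases (Suf 2 g).eq_empty_or_nonempty with he | ⟨v, hv⟩
  · simp [he]
  obtain ⟨-, w, ⟨hw, hp, -⟩, -⟩ := hv
  obtain ⟨s, W, k, h, -⟩ := exists_vert_eq_prod w hw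
  rw [hp] at h
  subst h
  obtain ⟨c, hc⟩ := exists_Suf_two_vert_subset s W k
  have hmem : letter c ∈ ({u, u⁻¹} : Set G) := by cases c <;> simp [letter]
  have hpair (x y : List G) : ({x, y} : Set (List G)).encard ≤ 2 := by
    simpa [one_add_one_eq_two] using Set.encard_insert_le {y} x
  constructor
  · rcases hc with hc | hc <;> exact (Set.encard_le_encard hc).trans (hpair _ _)
  · intro h2
    refine ⟨letter c, hmem, hc.imp (fun hc => ?_) (fun hc => ?_)⟩ <;>
      exact ((Set.toFinite _).subset hc).eq_of_subset_of_encard_le hc (h2 ▸ hpair _ _)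

end PSL2Z
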